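/- There is a universal constant C > 0 with the following property. Let n ≥ 1, let u, v ∈ ℝⁿ with u_α > 0 for all α, let 0 < g ≤ 1 and ε > 0 satisfy |v_α| ≤ ε·u_α for all α and ε²·n ≤ 1. Let d be the diagonal n×n matrix with diagonal entries u_α² and let b := g·v vᵀ. Then d + 2b is symmetric positive definite, and the matrix L₂ := (d+2b)^{1/2} [(d+2b)^{1/2} d (d+2b)^{1/2}]^{−1/2} (d+2b)^{1/2} − 𝟙 satisfies |(L₂)_{α,β}| ≤ C g ε² · min{u_α/u_β, u_β/u_α} for all α, β. -/

import Mathlib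

open Matrix

open scoped ComplexOrder in
/-- The positive semidefinite square root of a positive semidefinite matrix
(Mathlib's former `Matrix.PosSemidef.sqrt`, with its old definition). -/
noncomputable def Matrix.PosSemidef.sqrt {n 𝕜 : Type*} [Fintype n] [RCLike 𝕜] [DecidableEq n]
    {A : Matrix n n 𝕜} (hA : A.PosSemidef) : Matrix n n 𝕜 :=
  hA.1.eigenvectorUnitary.1 * Matrix.diagonal ((↑) ∘ Real.sqrt ∘ hA.1.eigenvalues) *
    (star hA.1.eigenvectorUnitary : Matrix n n 𝕜)

open scoped ComplexOrder in
lemma aux_sqrt_mul_self {m : ℕ} {A : Matrix (Fin m) (Fin m) ℝ} (hA : A.PosSemidef) :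
    hA.sqrt * hA.sqrt = A := by
  have hs := hA.1.spectral_theorem
  rw [Unitary.conjStarAlgAut_apply] at hs
  have hu : (star hA.1.eigenvectorUnitary : Matrix (Fin m) (Fin m) ℝ) *
      hA.1.eigenvectorUnitary.1 = 1 := Unitary.coe_star_mul_self _
  unfold Matrix.PosSemidef.sqrt
  set V := hA.1.eigenvectorUnitary.1
  conv_rhs => rw [hs]
  set E := Matrix.diagonal (((↑) : ℝ → ℝ) ∘ Real.sqrt ∘ hA.1.eigenvalues)
  have hE : E * E = Matrix.diagonal (((↑) : ℝ → ℝ) ∘ hA.1.eigenvalues) := by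
    simp only [E, Matrix.diagonal_mul_diagonal]
    congr 1
    funext i
    simp [Real.mul_self_sqrt (hA.eigenvalues_nonneg i)]
  calc V * E * star V * (V * E * star V) = V * E * (star V * V) * E * star V := by noncomm_ring
    _ = V * (E * E) * star V := by rw [hu]; noncomm_ring
    _ = _ := by rw [hE]; rfl

open scoped ComplexOrder in
lemma aux_sqrt_posSemidef {m : ℕ} {A : Matrix (Fin m) (Fin m) ℝ} (hA : A.PosSemidef) :
    hA.sqrt.PosSemidef := by
  unfold Matrix.PosSemidef.sqrt
  have h : (Matrix.diagonal (((↑) : ℝ → ℝ) ∘ Real.sqrt ∘ hA.1.eigenvalues)).PosSemidef := by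
    apply Matrix.PosSemidef.diagonal
    intro i
    simp [Real.sqrt_nonneg]
  exact h.mul_mul_conjTranspose_same hA.1.eigenvectorUnitary.1

lemma aux_sqrt_det {m : ℕ} {A : Matrix (Fin m) (Fin m) ℝ} (hA : A.PosDef) :
    IsUnit (hA.posSemidef.sqrt).det := by
  have h := congrArg Matrix.det (aux_sqrt_mul_self hA.posSemidef)
  rw [Matrix.det_mul] at h
  have := hA.det_pos
  rw [isUnit_iff_ne_zero]
  intro h0
  rw [h0] at h
  simp at h
  linarith

lemma aux_mono {m : ℕ} {Y : Matrix (Fin m) (Fin m) ℝ} (hY : Y.PosSemidef) (a : Fin m → ℝ)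
    (ha : ∀ i, 0 < a i) (g : ℝ) (hg : 0 < g) (w : Fin m → ℝ)
    (h : Y * Y = Matrix.diagonal (fun i => a i ^ 2) + (2 * g) • Matrix.vecMulVec w w) :
    (Y - Matrix.diagonal a).PosSemidef := by
  have hYt : Yᵀ = Y := by simpa using hY.1.eq
  have hK : (Y - Matrix.diagonal a).IsHermitian := by
    apply Matrix.IsHermitian.sub hY.1
    exact Matrix.isHermitian_diagonal a
  rw [hK.posSemidef_iff_eigenvalues_nonneg]
  intro i
  by_contra hlt
  simp only [Pi.zero_apply, not_le] at hlt
  set l := hK.eigenvalues i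
  set x : Fin m → ℝ := (hK.eigenvectorBasis i).ofLp with hx
  have hx0 : x ≠ 0 := by
    intro h0
    have h1 := hK.eigenvectorBasis.toBasis.ne_zero i
    apply h1
    ext j
    simpa using congrFun h0 j
  have hev : (Y - Matrix.diagonal a) *ᵥ x = l • x := hK.mulVec_eigenvectorBasis i
  rw [Matrix.sub_mulVec, sub_eq_iff_eq_add] at hev
  set y := Y *ᵥ x with hy
  set z := Matrix.diagonal a *ᵥ x with hz
  have hyy : y ⬝ᵥ y = z ⬝ᵥ z + 2 * g * (w ⬝ᵥ x) ^ 2 := by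
    have e1 : y ⬝ᵥ y = x ⬝ᵥ ((Y * Y) *ᵥ x) := by
      rw [← Matrix.mulVec_mulVec, Matrix.dotProduct_mulVec x Y, ← Matrix.mulVec_transpose, hYt]
    rw [e1, h, Matrix.add_mulVec, dotProduct_add]
    congr 1
    · simp only [dotProduct, hz, Matrix.mulVec_diagonal]
      exact Finset.sum_congr rfl fun j _ => by ring
    · rw [Matrix.smul_mulVec, Matrix.vecMulVec_mulVec]
      simp [dotProduct_smul, dotProduct_comm x w]
      left
      ring
  have hxy : 0 ≤ x ⬝ᵥ y := by simpa using hY.dotProduct_mulVec_nonneg x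
  have hxz : 0 < x ⬝ᵥ z := by
    have : (Matrix.diagonal a).PosDef := Matrix.PosDef.diagonal ha
    simpa using this.dotProduct_mulVec_pos hx0
  have e2 : y ⬝ᵥ y = z ⬝ᵥ z + l * (x ⬝ᵥ z) + l * (x ⬝ᵥ y) := by
    have p1 : y ⬝ᵥ y = l * (x ⬝ᵥ y) + z ⬝ᵥ y := by
      conv_lhs => lhs; rw [hev]
      simp [add_dotProduct, smul_dotProduct]
    have p2 : z ⬝ᵥ y = l * (x ⬝ᵥ z) + z ⬝ᵥ z := by
      rw [hev]
      simp [dotProduct_add, dotProduct_smul, dotProduct_comm z x]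
    rw [p1, p2]; ring
  nlinarith [mul_nonneg hg.le (sq_nonneg (w ⬝ᵥ x)), mul_neg_of_neg_of_pos hlt hxz,
    mul_nonneg (neg_nonneg.2 hlt.le) hxy]

lemma aux_bound {m : ℕ} {Y : Matrix (Fin m) (Fin m) ℝ} (hY : Y.PosSemidef) (a : Fin m → ℝ)
    (ha : ∀ i, 0 < a i) (g ε : ℝ) (hg : 0 < g) (w : Fin m → ℝ) (hw : ∀ i, |w i| ≤ ε * a i)
    (h : Y * Y = Matrix.diagonal (fun i => a i ^ 2) + (2 * g) • Matrix.vecMulVec w w)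
    (i j : Fin m) :
    (a i + a j) * |(Y - Matrix.diagonal a) i j| ≤ 4 * g * ε ^ 2 * (a i * a j) := by
  have hK := aux_mono hY a ha g hg w h
  set K := Y - Matrix.diagonal a with hKd
  have hYK : Y = K + Matrix.diagonal a := by simp [hKd]
  have hKs : ∀ p q, K p q = K q p := fun p q => by simpa using (hK.1.apply p q).symm
  have key : ∀ p q, (a p + a q) * K p q + ∑ r, K p r * K q r = 2 * g * (w p * w q) := by
    intro p q
    have e : (Y * Y) p q = K p q * a q + a p * K p q + (∑ r, K p r * K q r)
        + (Matrix.diagonal (fun i => a i ^ 2)) p q := by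
      have : ∑ r, K p r * K q r = (K * K) p q := by
        rw [Matrix.mul_apply]
        exact Finset.sum_congr rfl fun r _ => by rw [hKs q r]
      have dd : Matrix.diagonal a * Matrix.diagonal a = Matrix.diagonal (fun i => a i ^ 2) := by
        rw [Matrix.diagonal_mul_diagonal]; congr 1; funext r; ring
      rw [this, hYK, add_mul, mul_add, mul_add, dd]
      simp only [Matrix.add_apply, Matrix.mul_diagonal, Matrix.diagonal_mul]
      ring
    rw [h] at e
    simp only [Matrix.add_apply, Matrix.smul_apply, Matrix.vecMulVec_apply, smul_eq_mul] at e
    linarith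
  have hd : ∀ p, ∑ r, K p r ^ 2 ≤ 2 * g * (ε * a p) ^ 2 := by
    intro p
    have h1 := key p p
    have h2 : 0 ≤ K p p := hK.diag_nonneg
    have h3 : w p ^ 2 ≤ (ε * a p) ^ 2 := by
      rw [← sq_abs]; exact pow_le_pow_left₀ (abs_nonneg _) (hw p) 2
    have h4 : ∑ r, K p r ^ 2 = ∑ r, K p r * K p r := by simp [sq]
    rw [h4]
    nlinarith [mul_nonneg (ha p).le h2, mul_le_mul_of_nonneg_left h3 hg.le]
  have hε : ∀ p, 0 ≤ ε * a p := fun p => (abs_nonneg _).trans (hw p)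
  have hcs : |∑ r, K i r * K j r| ≤ 2 * g * ((ε * a i) * (ε * a j)) := by
    have hn : 0 ≤ 2 * g * ((ε * a i) * (ε * a j)) := by have := hε i; have := hε j; positivity
    apply abs_le_of_sq_le_sq _ hn
    calc (∑ r, K i r * K j r) ^ 2 ≤ (∑ r, K i r ^ 2) * ∑ r, K j r ^ 2 :=
          Finset.sum_mul_sq_le_sq_mul_sq _ _ _
      _ ≤ (2 * g * (ε * a i) ^ 2) * (2 * g * (ε * a j) ^ 2) :=
          mul_le_mul (hd i) (hd j) (Finset.sum_nonneg fun r _ => sq_nonneg _) (by positivity)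
      _ = _ := by ring
  have hww : |w i * w j| ≤ (ε * a i) * (ε * a j) := by
    rw [abs_mul]; exact mul_le_mul (hw i) (hw j) (abs_nonneg _) (hε i)
  have hpos : 0 < a i + a j := add_pos (ha i) (ha j)
  rw [← abs_of_pos hpos, ← abs_mul]
  have e := key i j
  rw [abs_le] at hcs hww ⊢
  constructor <;> nlinarith [mul_le_mul_of_nonneg_left hww.1 hg.le, mul_le_mul_of_nonneg_left hww.2 hg.le]

/-- There is a universal constant `C > 0` such that for all `n ≥ 1`,
weights `u_α > 0`, `|v_α| ≤ ε u_α`, `0 < g ≤ 1` and `ε² n ≤ 1`, the matrix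
`L₂ = (d+2b)^{1/2} [(d+2b)^{1/2} d (d+2b)^{1/2}]^{-1/2} (d+2b)^{1/2} - 𝟙` (with
`d = diag(u_α²)`, `b = g·v vᵀ`) satisfies
`|(L₂)_{α,β}| ≤ C g ε² min{u_α/u_β, u_β/u_α}`. -/
theorem L2_entrywise_bound :
    ∃ C : ℝ, 0 < C ∧ ∀ (n : ℕ), 1 ≤ n → ∀ (u v : Fin n → ℝ), (∀ α, 0 < u α) →
      ∀ (g ε : ℝ), 0 < g → g ≤ 1 → 0 < ε → (∀ α, |v α| ≤ ε * u α) → ε ^ 2 * n ≤ 1 →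
      ∃ h1 : ((Matrix.diagonal fun α => u α ^ 2)
          + 2 • (g • Matrix.vecMulVec v v)).PosDef,
        ∃ h2 : (h1.posSemidef.sqrt * (Matrix.diagonal fun α => u α ^ 2)
            * h1.posSemidef.sqrt).PosDef,
          ∀ α β : Fin n,
            |(h1.posSemidef.sqrt * (h2.posSemidef.sqrt)⁻¹ * h1.posSemidef.sqrt - 1) α β|
              ≤ C * g * ε ^ 2 * min (u α / u β) (u β / u α) := by
  refine ⟨4, by norm_num, ?_⟩
  intro n _ u v hu g ε hg _ hε hv _
  set D : Matrix (Fin n) (Fin n) ℝ := Matrix.diagonal fun α => u α ^ 2 with hD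
  have hDpos : D.PosDef := Matrix.PosDef.diagonal fun α => pow_pos (hu α) 2
  have h1 : (D + 2 • (g • Matrix.vecMulVec v v)).PosDef := by
    apply hDpos.add_posSemidef
    have := (Matrix.posSemidef_vecMulVec_self_star v).smul (mul_pos two_pos hg).le
    rw [two_nsmul, ← add_smul, ← two_mul]
    simpa using this
  refine ⟨h1, ?_⟩
  set B := h1.posSemidef.sqrt with hB
  have hBu : IsUnit B.det := aux_sqrt_det h1
  have hBps : B.PosSemidef := aux_sqrt_posSemidef h1.posSemidef
  have hBB := aux_sqrt_mul_self h1.posSemidef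
  rw [← hB] at hBB
  have hBH : Bᴴ = B := hBps.1.eq
  have h2 : (B * D * B).PosDef := by
    have := hDpos.conjTranspose_mul_mul_same (B := B)
      (Matrix.mulVec_injective_of_isUnit ((Matrix.isUnit_iff_isUnit_det _).2 hBu))
    rwa [hBH] at this
  refine ⟨h2, ?_⟩
  set S := h2.posSemidef.sqrt with hS
  have hSu : IsUnit S.det := aux_sqrt_det h2
  have hSps : S.PosSemidef := aux_sqrt_posSemidef h2.posSemidef
  have hSS := aux_sqrt_mul_self h2.posSemidef
  rw [← hS] at hSS
  set X := B * S⁻¹ * B with hX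
  have hXps : X.PosSemidef := by
    have := hSps.inv.conjTranspose_mul_mul_same B
    rwa [hBH] at this
  have hXDX : X * D * X = D + 2 • (g • Matrix.vecMulVec v v) := by
    calc X * D * X = B * S⁻¹ * (B * D * B) * S⁻¹ * B := by rw [hX]; noncomm_ring
      _ = B * (S⁻¹ * S) * (S * S⁻¹) * B := by rw [← hSS]; noncomm_ring
      _ = B * B := by rw [Matrix.nonsing_inv_mul _ hSu, Matrix.mul_nonsing_inv _ hSu]; simp
      _ = _ := hBB
  set U : Matrix (Fin n) (Fin n) ℝ := Matrix.diagonal u with hU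
  have hUU : U * U = D := by
    rw [hU, hD, Matrix.diagonal_mul_diagonal]; congr 1; funext r; ring
  have hYps : (U * X * U).PosSemidef := by
    have := hXps.conjTranspose_mul_mul_same U
    rwa [show Uᴴ = U from Matrix.isHermitian_diagonal u] at this
  have hYY : (U * X * U) * (U * X * U) = Matrix.diagonal (fun i => (u i ^ 2) ^ 2) +
      (2 * g) • Matrix.vecMulVec (fun i => u i * v i) (fun i => u i * v i) := by
    have : (U * X * U) * (U * X * U) = U * (X * (U * U) * X) * U := by noncomm_ring
    rw [this, hUU, hXDX, two_nsmul]
    ext p q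
    simp only [hU, hD, Matrix.mul_diagonal, Matrix.diagonal_mul, Matrix.add_apply,
      Matrix.smul_apply, Matrix.vecMulVec_apply, smul_eq_mul, Matrix.diagonal_apply]
    split_ifs with hpq
    · subst hpq; ring
    · ring
  intro α β
  have hb := aux_bound hYps (fun i => u i ^ 2) (fun i => pow_pos (hu i) 2) g ε hg _
    (fun i => by
      rw [abs_mul, abs_of_pos (hu i)]
      nlinarith [mul_le_mul_of_nonneg_left (hv i) (hu i).le]) hYY α β
  have hXe : (U * X * U - Matrix.diagonal fun i => u i ^ 2) α β = u α * u β * (X - 1) α β := by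
    simp only [hU, Matrix.sub_apply, Matrix.mul_diagonal, Matrix.diagonal_mul,
      Matrix.diagonal_apply, Matrix.one_apply]
    split_ifs with hpq
    · subst hpq; ring
    · ring
  have ha := hu α
  have hb' := hu β
  rw [hXe, abs_mul, abs_of_pos (mul_pos ha hb')] at hb
  set t := |(X - 1) α β|
  have ht : 0 ≤ t := abs_nonneg _
  have hmain : (u α ^ 2 + u β ^ 2) * t ≤ 4 * g * ε ^ 2 * (u α * u β) := by
    have hp := mul_pos ha hb'
    refine le_of_mul_le_mul_left ?_ hp
    linarith
  have hA1 := mul_nonneg (sq_nonneg (u α)) ht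
  have hA2 := mul_nonneg (sq_nonneg (u β)) ht
  rcases min_choice (u α / u β) (u β / u α) with hm | hm
  · rw [hm, ← mul_div_assoc, le_div_iff₀ hb']
    refine le_of_mul_le_mul_left ?_ hb'
    linarith
  · rw [hm, ← mul_div_assoc, le_div_iff₀ ha]
    refine le_of_mul_le_mul_left ?_ ha
    linarith
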